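/- Let G be a free group of finite rank r with free generating set S, acting on a standard Borel probability space (X, μ) by μ-preserving Borel automorphisms, let Σ be a G-invariant sub-σ-algebra, and let α be a generating partition with H(α) < ∞. For s ∈ S and a countable measurable partition β with H(β) < ∞, let h_{⟨s⟩}(X, μ/Σ, β) = lim_{k→∞} H(β / ⋁_{m=1}^{k} s^{−m}·β ∨ Σ) (the sequence is non-increasing in k, so the limit exists). Then f_G(X, μ/Σ) = lim_{n→∞} [(1 − r)·H(B_n·α / Σ) + ∑_{s ∈ S} h_{⟨s⟩}(X, μ/Σ, B_n·α)], an equality in [−∞, ∞). -/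

import Mathlib

open MeasureTheory Filter Set
open scoped ENNReal symmDiff Pointwise

namespace FPaper

/-- The free group of rank `r`; its free generating set `S` is `{FreeGroup.of i | i : Fin r}`. -/
abbrev FG (r : ℕ) := FreeGroup (Fin r)

/-- The reduced `S`-word length of a group element. -/
def wlen {r : ℕ} (g : FG r) : ℕ := g.toWord.length

/-- The ball of radius `n` in `FG r` with respect to the word length. -/
def ball (r n : ℕ) : Set (FG r) := {g | wlen g ≤ n}

instance ballFinite (r n : ℕ) : Finite (ball r n) := by
  have h : ball r n ⊆ FreeGroup.mk '' {l : List (Fin r × Bool) | l.length ≤ n} :=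
    fun g hg => ⟨g.toWord, hg, FreeGroup.mk_toWord⟩
  exact (((List.finite_length_le _ n).image _).subset h).to_subtype

/-- An action of a group `G` on a measurable space `X` by Borel automorphisms. -/
structure BorelAction (G : Type*) [Group G] (X : Type*) [MeasurableSpace X] where
  act : G → X → X
  act_one : ∀ x, act 1 x = x
  act_mul : ∀ g h x, act (g * h) x = act g (act h x)
  measurable_act : ∀ g, Measurable (act g)

namespace BorelAction

variable {G X : Type*} [Group G] [mX : MeasurableSpace X]

/-- The action preserves the measure `μ`. -/
def Preserves (T : BorelAction G X) (μ : Measure X) : Prop :=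
  ∀ g : G, MeasurePreserving (T.act g) μ μ

/-- The translated set `g · B`. -/
def smulSet (T : BorelAction G X) (g : G) (B : Set X) : Set X := T.act g⁻¹ ⁻¹' B

/-- The translated partition `g · α`, where a countable measurable partition is recorded
by a (measurable, countably-valued) function whose fibers are the cells. -/
def tr {I : Type*} (T : BorelAction G X) (g : G) (a : X → I) : X → I :=
  fun x => a (T.act g⁻¹ x)

/-- The join `F · α = ⋁_{f ∈ F} f · α` of the translates of a partition over a set `F ⊆ G`. -/
def joinF {I : Type*} (T : BorelAction G X) (F : Set G) (a : X → I) : X → (F → I) :=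
  fun x f => a (T.act (f : G)⁻¹ x)

/-- The σ-algebra generated by the partitions `f · α`, `f ∈ F`. -/
def partSA {I : Type*} (T : BorelAction G X) (F : Set G) (a : X → I) : MeasurableSpace X :=
  ⨆ f ∈ F, MeasurableSpace.comap (T.tr f a) ⊤

/-- The partition `a` is generating: the smallest `G`-invariant σ-algebra containing `a`
(i.e. the one generated by all translates of `a`) contains every measurable set up to
`ν`-null sets. -/
def Generating {I : Type*} (T : BorelAction G X) (a : X → I) (ν : Measure X) : Prop :=
  ∀ B : Set X, MeasurableSet B →
    ∃ B', MeasurableSet[T.partSA Set.univ a] B' ∧ ν (B ∆ B') = 0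


/-- Ergodicity of the action with respect to `ν`. -/
def IsErgodic (T : BorelAction G X) (ν : Measure X) : Prop :=
  ∀ B : Set X, MeasurableSet B → (∀ g : G, ν (T.smulSet g B ∆ B) = 0) → ν B = 0 ∨ ν B = 1

/-- The action is essentially free with respect to `ν`. -/
def EssentiallyFree (T : BorelAction G X) (ν : Measure X) : Prop :=
  ν {x | ∀ g : G, g ≠ 1 → T.act g x ≠ x} = 1

/-- The stabilizer subgroup of a point. -/
def stab (T : BorelAction G X) (y : X) : Subgroup G where
  carrier := {g | T.act g y = y}
  one_mem' := T.act_one y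
  mul_mem' := by
    intro g h hg hh
    simp only [Set.mem_setOf_eq] at *
    rw [T.act_mul, hh, hg]
  inv_mem' := by
    intro g hg
    simp only [Set.mem_setOf_eq] at *
    conv_lhs => rw [← hg]
    rw [← T.act_mul, inv_mul_cancel, T.act_one]

end BorelAction

/-- `m` is a `G`-invariant sub-σ-algebra. -/
def InvariantSA {G X : Type*} [Group G] (m : MeasurableSpace X) [mX : MeasurableSpace X]
    (T : BorelAction G X) : Prop :=
  m ≤ mX ∧ ∀ (g : G) (B : Set X), MeasurableSet[m] B → MeasurableSet[m] (T.act g ⁻¹' B)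

/-- A measure is purely atomic: the set of atoms has full measure. -/
def PurelyAtomic {X : Type*} [MeasurableSpace X] (ν : Measure X) : Prop :=
  ν {x | 0 < ν {x}} = 1

/-- Shannon entropy of a countable measurable partition (recorded as a countably-valued
function), with values in `[0, ∞]`. -/
noncomputable def Hpart {X I : Type*} [MeasurableSpace X] [Countable I]
    (μ : Measure X) (a : X → I) : ℝ≥0∞ :=
  ∑' i : I, ENNReal.ofReal (Real.negMulLog (μ (a ⁻¹' {i})).toReal)

/-- Conditional Shannon entropy of a countable partition given a sub-σ-algebra `m`:
`H(α/m) = ∫ ∑_{A ∈ α} φ(E[1_A | m](x)) dμ(x)` with `φ(t) = -t log t`. -/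
noncomputable def condEntS {X I : Type*} (m : MeasurableSpace X) [mX : MeasurableSpace X]
    [Countable I] (μ : Measure X) (a : X → I) : ℝ≥0∞ :=
  ∫⁻ x, ∑' i : I,
    ENNReal.ofReal (Real.negMulLog ((μ[(a ⁻¹' {i}).indicator (fun _ => (1:ℝ)) | m]) x)) ∂μ

/-- Conditional Shannon entropy of a partition given another partition:
`H(α/β) = ∑_{B ∈ β} ∑_{A ∈ α} -μ(B) · (μ(A∩B)/μ(B)) · log (μ(A∩B)/μ(B))`
(equivalently `H(α ∨ β) − H(β)`), with values in `[0, ∞]`. -/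
noncomputable def condEntP {X I J : Type*} [MeasurableSpace X] [Countable I] [Countable J]
    (μ : Measure X) (a : X → I) (b : X → J) : ℝ≥0∞ :=
  ∑' q : I × J, μ (b ⁻¹' {q.2}) *
    ENNReal.ofReal (Real.negMulLog
      ((μ (a ⁻¹' {q.1} ∩ b ⁻¹' {q.2})).toReal / (μ (b ⁻¹' {q.2})).toReal))

/-- `F_G(X, μ, S, β) = (1-2r)·H(β) + ∑_{s ∈ S} H(s·β ∨ β)`. -/
noncomputable def FF {r : ℕ} {X I : Type*} [MeasurableSpace X] [Countable I]
    (μ : Measure X) (T : BorelAction (FG r) X) (b : X → I) : ℝ :=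
  (1 - 2 * (r : ℝ)) * (Hpart μ b).toReal
    + ∑ i : Fin r, (Hpart μ (fun x => (T.tr (FreeGroup.of i) b x, b x))).toReal

/-- The sequence `n ↦ F_G(X, μ, S, B_n · α)`. -/
noncomputable def fSeq {r : ℕ} {X : Type*} [MeasurableSpace X]
    (μ : Measure X) (T : BorelAction (FG r) X) (a : X → ℕ) (n : ℕ) : ℝ :=
  FF μ T (T.joinF (ball r n) a)

/-- The f-invariant entropy `f_G(X, μ) = lim_n F_G(X, μ, S, B_n·α)`, the limit (= infimum,
since the sequence is non-increasing) of the sequence `fSeq`, with values in `[-∞, ∞)`. -/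
noncomputable def fInv {r : ℕ} {X : Type*} [MeasurableSpace X]
    (μ : Measure X) (T : BorelAction (FG r) X) (a : X → ℕ) : EReal :=
  ⨅ n : ℕ, ((fSeq μ T a n : ℝ) : EReal)

/-- Relative version `F_G(X, μ/Σ, S, β) = (1-2r)·H(β/Σ) + ∑_{s ∈ S} H(s·β ∨ β / Σ)`. -/
noncomputable def FFrel {r : ℕ} {X I : Type*} (m : MeasurableSpace X) [mX : MeasurableSpace X]
    [Countable I] (μ : Measure X) (T : BorelAction (FG r) X) (b : X → I) : ℝ :=
  (1 - 2 * (r : ℝ)) * (condEntS m μ b).toReal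
    + ∑ i : Fin r, (condEntS m μ (fun x => (T.tr (FreeGroup.of i) b x, b x))).toReal

/-- The sequence `n ↦ F_G(X, μ/Σ, S, B_n · α)`. -/
noncomputable def fSeqRel {r : ℕ} {X : Type*} (m : MeasurableSpace X) [mX : MeasurableSpace X]
    (μ : Measure X) (T : BorelAction (FG r) X) (a : X → ℕ) (n : ℕ) : ℝ :=
  FFrel m μ T (T.joinF (ball r n) a)

/-- The relative f-invariant entropy `f_G(X, μ/Σ)`, with values in `[-∞, ∞)`. -/
noncomputable def fInvRel {r : ℕ} {X : Type*} (m : MeasurableSpace X) [mX : MeasurableSpace X]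
    (μ : Measure X) (T : BorelAction (FG r) X) (a : X → ℕ) : EReal :=
  ⨅ n : ℕ, ((fSeqRel m μ T a n : ℝ) : EReal)

/-- A total order on `S ∪ S⁻¹` is recorded by an injection `ord : Fin r × Bool → ℕ`;
`g ≺ h` iff `|g| < |h|`, or `|g| = |h|` and the reduced word of `g` lexicographically
precedes that of `h`. -/
def wlt {r : ℕ} (ord : Fin r × Bool → ℕ) (g h : FG r) : Prop :=
  wlen g < wlen h ∨ (wlen g = wlen h ∧ List.Lex (fun p q => ord p < ord q) g.toWord h.toWord)

/-- `Pre(g)`: the set of elements strictly preceding `g`. -/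
def Pre {r : ℕ} (ord : Fin r × Bool → ℕ) (g : FG r) : Set (FG r) := {h | wlt ord h g}

/-- The generator or inverse generator corresponding to a letter. -/
def letter {r : ℕ} (p : Fin r × Bool) : FG r :=
  if p.2 then FreeGroup.of p.1 else (FreeGroup.of p.1)⁻¹

/-- The first (leftmost) letter of the reduced word of `g` (junk value `1` for `g = 1`). -/
def firstLetter {r : ℕ} (g : FG r) : FG r := ((g.toWord.head?).map letter).getD 1

/-- The independence decay `δ(g, α/Σ)`, as a real number:
`δ(g, α/Σ) = H(s⁻¹g·α / Pre(s⁻¹g)·α ∨ Σ) − H(g·α / Pre(g)·α ∨ Σ)` where `s` is the first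
letter of `g`. -/
noncomputable def idecay {r : ℕ} {X I : Type*} (m : MeasurableSpace X) [mX : MeasurableSpace X]
    [Countable I] (μ : Measure X) (T : BorelAction (FG r) X)
    (ord : Fin r × Bool → ℕ) (a : X → I) (g : FG r) : ℝ :=
  (condEntS (m ⊔ T.partSA (Pre ord ((firstLetter g)⁻¹ * g)) a) μ
      (T.tr ((firstLetter g)⁻¹ * g) a)).toReal
  - (condEntS (m ⊔ T.partSA (Pre ord g) a) μ (T.tr g a)).toReal

/-- The entropy `H(τ)` of a probability space: the supremum of the Shannon entropies of
finite measurable partitions. -/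
noncomputable def measEnt {M : Type*} [MeasurableSpace M] (τ : Measure M) : ℝ≥0∞ :=
  ⨆ (P : Finset (Set M)) (_ : ∀ p ∈ P, MeasurableSet p)
    (_ : (P : Set (Set M)).PairwiseDisjoint id) (_ : ⋃₀ (P : Set (Set M)) = Set.univ),
    ∑ p ∈ P, ENNReal.ofReal (Real.negMulLog (τ p).toReal)

/-- The non-negative part of an extended real, in `ℝ≥0∞`. -/
noncomputable def erealToENNReal (x : EReal) : ℝ≥0∞ :=
  if x = ⊤ then ⊤ else ENNReal.ofReal x.toReal

/-- The integral of an `EReal`-valued function (positive part minus negative part),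
with values in `[-∞, ∞]`. -/
noncomputable def eIntegral {M : Type*} [MeasurableSpace M] (τ : Measure M) (f : M → EReal) :
    EReal :=
  ((∫⁻ m, erealToENNReal (f m) ∂τ : ℝ≥0∞) : EReal)
    - ((∫⁻ m, erealToENNReal (-(f m)) ∂τ : ℝ≥0∞) : EReal)

/-- The set of `G`-invariant Borel probability measures on `X`. -/
def InvProb {G X : Type*} [Group G] [MeasurableSpace X] (T : BorelAction G X) :
    Set (Measure X) :=
  {ν | IsProbabilityMeasure ν ∧ ∀ g : G, MeasurePreserving (T.act g) ν ν}

/-- The functional `F_G` evaluated on a real-valued function of finite subsets of the free group. -/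
noncomputable def setF {r : ℕ} (h : Finset (FG r) → ℝ) (E : Finset (FG r)) : ℝ :=
  (1 - 2 * (r : ℝ)) * h E + ∑ i : Fin r, h (FreeGroup.of i • E ∪ E)

/-- A left-invariant function of finite subsets with the diminishing-returns property. -/
structure InvSubmodular {r : ℕ} (h : Finset (FG r) → ℝ) : Prop where
  union_add_le : ∀ X Y Z : Finset (FG r), Z ⊆ Y → h (X ∪ Y) + h Z ≤ h (X ∪ Z) + h Y
  smul_eq : ∀ (g : FG r) (E : Finset (FG r)), h (g • E) = h E

namespace InvSubmodular

variable {r : ℕ} {h : Finset (FG r) → ℝ}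

theorem smul_insert_union_le (hh : InvSubmodular h) (s x : FG r) (E : Finset (FG r)) :
    h (s • insert x E ∪ insert x E) ≤
      h (s • E ∪ insert x E) + (h (insert x E) - h E) := by
  have h1 := hh.union_add_le (s • insert x E) (s • E ∪ insert x E) (s • E)
    Finset.subset_union_left
  have hs : s • E ⊆ s • insert x E := Finset.smul_finset_subset_smul_finset (by simp)
  rw [← Finset.union_assoc, Finset.union_eq_left.2 hs, hh.smul_eq, hh.smul_eq] at h1
  linarith

theorem smul_union_insert_le (hh : InvSubmodular h) (s x : FG r) (E : Finset (FG r)) :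
    h (s • E ∪ insert x E) ≤ h (s • E ∪ E) + (h (insert x E) - h E) := by
  have h1 := hh.union_add_le {x} (s • E ∪ E) E Finset.subset_union_right
  have e : ({x} : Finset (FG r)) ∪ (s • E ∪ E) = s • E ∪ insert x E := by
    ext y; simp only [Finset.mem_union, Finset.mem_insert, Finset.mem_singleton]; tauto
  rw [e, ← Finset.insert_eq] at h1
  linarith

/-- Adjoining a neighbour of an element of `E` does not increase the functional. -/
theorem setF_insert_le (hh : InvSubmodular h) (E : Finset (FG r)) (x : FG r) (j : Fin r)
    (hx : (FreeGroup.of j)⁻¹ * x ∈ E ∨ FreeGroup.of j * x ∈ E) :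
    setF h (insert x E) ≤ setF h E := by
  set d := h (insert x E) - h E with hd
  have hgen : ∀ i : Fin r, h (FreeGroup.of i • insert x E ∪ insert x E) ≤
      h (FreeGroup.of i • E ∪ E) + (2 * d - if i = j then d else 0) := by
    intro i
    have h1 := hh.smul_insert_union_le (FreeGroup.of i) x E
    have h2 := hh.smul_union_insert_le (FreeGroup.of i) x E
    split_ifs with hij
    · subst hij
      rcases hx with hx | hx
      · have e : FreeGroup.of i • E ∪ insert x E = FreeGroup.of i • E ∪ E := by
          have : x ∈ FreeGroup.of i • E :=
            Finset.mem_smul_finset.2 ⟨_, hx, by simp⟩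
          rw [Finset.union_insert, Finset.insert_eq_of_mem (by simp [this])]
        rw [e] at h1
        linarith
      · have e : FreeGroup.of i • insert x E ∪ insert x E =
            FreeGroup.of i • E ∪ insert x E := by
          rw [Finset.smul_finset_insert, Finset.insert_union, Finset.insert_eq_of_mem]
          simp [hx]
        rw [e]
        linarith
    · linarith
  have hsum := Finset.sum_le_sum fun i (_ : i ∈ Finset.univ) => hgen i
  rw [Finset.sum_add_distrib, Finset.sum_sub_distrib] at hsum
  simp only [Finset.sum_const, Finset.card_univ, Fintype.card_fin, nsmul_eq_mul,
    Finset.sum_ite_eq', Finset.mem_univ, if_true] at hsum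
  unfold setF
  have : h (insert x E) = h E + d := by rw [hd]; ring
  rw [this]
  linarith

end InvSubmodular

/-- A nontrivial group element has a neighbour of smaller word length. -/
theorem exists_wlen_lt {r : ℕ} {x : FG r} (hx : x ≠ 1) :
    ∃ j : Fin r, wlen ((FreeGroup.of j)⁻¹ * x) < wlen x ∨ wlen (FreeGroup.of j * x) < wlen x := by
  have hmk : FreeGroup.mk x.toWord = x := FreeGroup.mk_toWord
  rcases hw : x.toWord with _ | ⟨⟨j, b⟩, l⟩
  · exact absurd (FreeGroup.toWord_eq_nil_iff.1 hw) hx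
  · rw [hw] at hmk
    have hlen : wlen (FreeGroup.mk l) < wlen x := by
      have : (FreeGroup.mk l).toWord.length ≤ l.length := FreeGroup.norm_mk_le
      unfold wlen
      rw [hw, List.length_cons]
      omega
    have hcons : x = FreeGroup.mk [(j, b)] * FreeGroup.mk l := by
      rw [FreeGroup.mul_mk, ← hmk]; rfl
    refine ⟨j, ?_⟩
    cases b
    · right
      have : FreeGroup.of j * x = FreeGroup.mk l := by
        have e : FreeGroup.mk [(j, false)] = (FreeGroup.of j)⁻¹ := by
          simp [FreeGroup.of, FreeGroup.invRev]
        rw [hcons, e]; simp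
      rwa [this]
    · left
      have : (FreeGroup.of j)⁻¹ * x = FreeGroup.mk l := by
        have e : FreeGroup.mk [(j, true)] = FreeGroup.of j := rfl
        rw [hcons, e]; simp
      rwa [this]

/-- The ball of radius `n` as a finite set. -/
noncomputable def ballFinset (r n : ℕ) : Finset (FG r) := (Set.toFinite (ball r n)).toFinset

theorem mem_ballFinset {r n : ℕ} {g : FG r} : g ∈ ballFinset r n ↔ wlen g ≤ n := by
  simp [ballFinset, ball]

theorem coe_ballFinset (r n : ℕ) : (ballFinset r n : Set (FG r)) = ball r n := by
  simp [ballFinset]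

theorem one_mem_ballFinset (r n : ℕ) : (1 : FG r) ∈ ballFinset r n := by
  simp [mem_ballFinset, wlen]

namespace InvSubmodular

variable {r : ℕ} {h : Finset (FG r) → ℝ}

theorem setF_ballFinset_le (hh : InvSubmodular h) {n : ℕ} (E : Finset (FG r)) (h1 : 1 ∈ E)
    (hE : E ⊆ ballFinset r n) : setF h (ballFinset r n) ≤ setF h E := by
  induction hk : (ballFinset r n \ E).card generalizing E with
  | zero =>
    rw [Finset.card_eq_zero, Finset.sdiff_eq_empty_iff_subset] at hk
    rw [hE.antisymm hk]
  | succ _ ih =>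
    have hne : (ballFinset r n \ E).Nonempty := by
      rw [← Finset.card_pos]; omega
    obtain ⟨x, hx, hmin⟩ := Finset.exists_min_image _ wlen hne
    obtain ⟨hxn, hxE⟩ := Finset.mem_sdiff.1 hx
    have hlt : ∀ y : FG r, wlen y < wlen x → y ∈ E := by
      intro y hy
      by_contra hyE
      have := hmin y (Finset.mem_sdiff.2
        ⟨mem_ballFinset.2 (hy.le.trans (mem_ballFinset.1 hxn)), hyE⟩)
      omega
    obtain ⟨j, hj⟩ := exists_wlen_lt (x := x) (by rintro rfl; exact hxE h1)
    refine (ih (insert x E) (by simp [h1]) (Finset.insert_subset hxn hE) ?_).trans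
      (hh.setF_insert_le E x j (hj.imp (hlt _) (hlt _)))
    rw [Finset.sdiff_insert, Finset.card_erase_of_mem hx, hk]
    rfl

theorem antitone_setF_ballFinset (hh : InvSubmodular h) :
    Antitone fun n => setF h (ballFinset r n) := fun n _ hnk =>
  hh.setF_ballFinset_le _ (one_mem_ballFinset r n) fun _ hg =>
    mem_ballFinset.2 ((mem_ballFinset.1 hg).trans hnk)

theorem exists_setF_ballFinset_le (hh : InvSubmodular h) (E : Finset (FG r)) (h1 : 1 ∈ E) :
    ∃ n, setF h (ballFinset r n) ≤ setF h E :=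
  ⟨E.sup wlen, hh.setF_ballFinset_le E h1 fun _ hg => mem_ballFinset.2 (Finset.le_sup hg)⟩

end InvSubmodular

/-- The union of the translates `s⁻ᵐ E` for `m < k`. -/
def line {r : ℕ} (s : FG r) (E : Finset (FG r)) (k : ℕ) : Finset (FG r) :=
  (Finset.range k).biUnion fun m => (s ^ m)⁻¹ • E

theorem line_succ {r : ℕ} (s : FG r) (E : Finset (FG r)) (k : ℕ) :
    line s E (k + 1) = E ∪ s⁻¹ • line s E k := by
  ext y
  simp only [line, Finset.mem_union, Finset.mem_biUnion, Finset.mem_range,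
    Finset.mem_inv_smul_finset_iff, Nat.exists_lt_succ_left, pow_zero, one_smul, pow_succ,
    mul_smul]

theorem smul_line_succ {r : ℕ} (s : FG r) (E : Finset (FG r)) (k : ℕ) :
    s • line s E (k + 1) = s • E ∪ line s E k := by
  rw [line_succ, Finset.smul_finset_union, smul_inv_smul]

theorem line_mono {r : ℕ} (s : FG r) (E : Finset (FG r)) : Monotone (line s E) :=
  fun _ _ hkl => Finset.biUnion_subset_biUnion_of_subset_left _ (Finset.range_mono hkl)

theorem line_one {r : ℕ} (s : FG r) (E : Finset (FG r)) : line s E 1 = E := by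
  simp [line]

namespace InvSubmodular

variable {r : ℕ} {h : Finset (FG r) → ℝ}

theorem union_biUnion_le (hh : InvSubmodular h) {ι : Type*} (B : Finset (FG r))
    (L : ι → Finset (FG r)) (hL : ∀ i, B ⊆ L i) (t : Finset ι) :
    h (B ∪ t.biUnion L) ≤ h B + ∑ i ∈ t, (h (L i) - h B) := by
  classical
  induction t using Finset.induction_on with
  | empty => simp
  | insert i t hi ih =>
    have h1 := hh.union_add_le (L i) (B ∪ t.biUnion L) B Finset.subset_union_left
    have e : L i ∪ (B ∪ t.biUnion L) = B ∪ (insert i t).biUnion L := by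
      rw [Finset.biUnion_insert, Finset.union_left_comm]
    rw [e, Finset.union_eq_left.2 (hL i)] at h1
    rw [Finset.sum_insert hi]
    linarith

theorem exists_setF_ballFinset_le_line (hh : InvSubmodular h) (B : Finset (FG r)) (h1 : 1 ∈ B)
    (k : ℕ) : ∃ n, setF h (ballFinset r n) ≤ (1 - (r : ℝ)) * h B +
      ∑ i : Fin r, (h (line (FreeGroup.of i) B (k + 2)) - h (line (FreeGroup.of i) B (k + 1))) := by
  set L : Fin r → Finset (FG r) := fun i => line (FreeGroup.of i) B (k + 1) with hL
  set E := B ∪ Finset.univ.biUnion L with hE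
  have hLE : ∀ i, L i ⊆ E := fun i =>
    (Finset.subset_biUnion_of_mem L (Finset.mem_univ i)).trans Finset.subset_union_right
  have hBL : ∀ i, B ⊆ L i := fun i => by
    simp only [hL, line_succ]; exact Finset.subset_union_left
  have hunion := hh.union_biUnion_le B L hBL Finset.univ
  have hstep : ∀ i : Fin r, h (FreeGroup.of i • E ∪ E) ≤
      2 * h E + (h (line (FreeGroup.of i) B (k + 2)) - 2 * h (L i)) := by
    intro i
    set s := FreeGroup.of i with hs
    have e : s • line s B (k + 2) = s • B ∪ L i := smul_line_succ s B (k + 1)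
    have hle : L i ⊆ line s B (k + 2) := line_mono s B (by omega)
    have a1 := hh.union_add_le (s • line s B (k + 2)) E (L i) (hLE i)
    have a2 := hh.union_add_le (s • E) (s • line s B (k + 2) ∪ E) (s • L i)
      ((Finset.smul_finset_subset_smul_finset hle).trans Finset.subset_union_left)
    have e1 : s • line s B (k + 2) ∪ L i = s • line s B (k + 2) := by
      rw [e, Finset.union_assoc, Finset.union_self]
    have e2 : s • E ∪ (s • line s B (k + 2) ∪ E) = s • E ∪ E := by
      rw [e, Finset.union_assoc (s • B), Finset.union_eq_right.2 (hLE i), ← Finset.union_assoc,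
        Finset.union_eq_left.2 (Finset.smul_finset_subset_smul_finset Finset.subset_union_left)]
    have e3 : s • E ∪ s • L i = s • E :=
      Finset.union_eq_left.2 (Finset.smul_finset_subset_smul_finset (hLE i))
    rw [e1, hh.smul_eq] at a1
    rw [e2, e3, hh.smul_eq, hh.smul_eq] at a2
    linarith
  obtain ⟨n, hn⟩ := hh.exists_setF_ballFinset_le E (Finset.mem_union_left _ h1)
  refine ⟨n, hn.trans ?_⟩
  have hsum := Finset.sum_le_sum fun i (_ : i ∈ Finset.univ) => hstep i
  simp only [Finset.sum_add_distrib, Finset.sum_sub_distrib, Finset.sum_const, Finset.card_univ,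
    Fintype.card_fin, nsmul_eq_mul, ← Finset.mul_sum] at hsum hunion ⊢
  unfold setF
  linarith

end InvSubmodular

/-- The conditional probability of the set `A` given the σ-algebra `m`. -/
noncomputable def condP {X : Type*} (m : MeasurableSpace X) [mX : MeasurableSpace X]
    (μ : Measure X) (A : Set X) : X → ℝ :=
  μ[A.indicator (fun _ => (1 : ℝ)) | m]

section CondP

theorem measurableSet_fiber {X J : Type*} (b : X → J) (j : J) :
    MeasurableSet[MeasurableSpace.comap b ⊤] (b ⁻¹' {j}) :=
  ⟨{j}, trivial, rfl⟩

/-- Every set of the σ-algebra generated by `m` and a partition agrees on each cell of the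
partition with a set of `m`. -/
theorem exists_inter_fiber_eq {X J : Type*} {m : MeasurableSpace X} (b : X → J) (j : J) {C : Set X}
    (hC : MeasurableSet[m ⊔ MeasurableSpace.comap b ⊤] C) :
    ∃ M, MeasurableSet[m] M ∧ C ∩ b ⁻¹' {j} = M ∩ b ⁻¹' {j} := by
  let σ : MeasurableSpace X :=
    { MeasurableSet' := fun C => ∃ M, MeasurableSet[m] M ∧ C ∩ b ⁻¹' {j} = M ∩ b ⁻¹' {j}
      measurableSet_empty := ⟨∅, @MeasurableSet.empty _ m, rfl⟩
      measurableSet_compl := by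
        rintro C ⟨M, hM, h⟩
        refine ⟨Mᶜ, hM.compl, ?_⟩
        ext x
        have := Set.ext_iff.1 h x
        simp only [mem_inter_iff, mem_compl_iff] at this ⊢
        tauto
      measurableSet_iUnion := by
        intro f hf
        choose M hM h using hf
        refine ⟨⋃ i, M i, MeasurableSet.iUnion hM, ?_⟩
        rw [iUnion_inter, iUnion_inter]
        exact iUnion_congr h }
  have hle : m ⊔ MeasurableSpace.comap b ⊤ ≤ σ := by
    refine sup_le (fun C hC => ⟨C, hC, rfl⟩) ?_
    rintro C ⟨t, -, rfl⟩
    by_cases hj : j ∈ t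
    · refine ⟨univ, @MeasurableSet.univ _ m, ?_⟩
      ext x
      simp only [mem_inter_iff, mem_preimage, mem_singleton_iff, mem_univ, true_and,
        and_iff_right_iff_imp]
      rintro rfl
      exact hj
    · refine ⟨∅, @MeasurableSet.empty _ m, ?_⟩
      ext x
      simp only [mem_inter_iff, mem_preimage, mem_singleton_iff, mem_empty_iff_false, false_and,
        iff_false, not_and]
      rintro hx rfl
      exact hj hx
  exact hle C hC

variable {X : Type*} {m n : MeasurableSpace X} [mX : MeasurableSpace X] {μ : Measure X}

theorem measurable_condP (A : Set X) : Measurable[m] (condP m μ A) :=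
  stronglyMeasurable_condExp.measurable

theorem measurable_ofReal_condP (A : Set X) :
    Measurable[m] fun x => ENNReal.ofReal (condP m μ A x) :=
  (measurable_condP A).ennreal_ofReal

theorem integrable_condP (A : Set X) : Integrable (condP m μ A) μ := integrable_condExp

theorem condP_nonneg (A : Set X) : ∀ᵐ x ∂μ, 0 ≤ condP m μ A x :=
  condExp_nonneg (Eventually.of_forall fun _ => indicator_nonneg (fun _ _ => zero_le_one) _)

variable [IsProbabilityMeasure μ] {A : Set X}

theorem integrable_indicator_one (hA : MeasurableSet A) :
    Integrable (A.indicator fun _ => (1 : ℝ)) μ :=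
  (integrable_const 1).indicator hA

theorem condP_le_one (hm : m ≤ mX) (hA : MeasurableSet A) : ∀ᵐ x ∂μ, condP m μ A x ≤ 1 := by
  have h := condExp_mono (m := m) (integrable_indicator_one (μ := μ) hA) (integrable_const 1)
    (Eventually.of_forall fun x => indicator_le_self' (fun _ _ => zero_le_one) x)
  rw [condExp_const hm] at h
  exact h

theorem setLIntegral_condP (hm : m ≤ mX) (hA : MeasurableSet A) {s : Set X}
    (hs : MeasurableSet[m] s) :
    ∫⁻ x in s, ENNReal.ofReal (condP m μ A x) ∂μ = μ (s ∩ A) := by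
  rw [← ofReal_integral_eq_lintegral_ofReal (integrable_condP A).restrict
    (ae_restrict_of_ae (condP_nonneg A)), condP, setIntegral_condExp hm
    (integrable_indicator_one hA) hs, setIntegral_indicator hA]
  simp

/-- Integrating an `m`-measurable function against the conditional probability of `A` amounts to
integrating it over `A`. -/
theorem lintegral_condP_mul (hm : m ≤ mX) (hA : MeasurableSet A) {g : X → ℝ≥0∞}
    (hg : Measurable[m] g) :
    ∫⁻ x, ENNReal.ofReal (condP m μ A x) * g x ∂μ = ∫⁻ x in A, g x ∂μ := by
  have hp : Measurable fun x => ENNReal.ofReal (condP m μ A x) :=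
    ((measurable_condP A).mono hm le_rfl).ennreal_ofReal
  have htrim : (μ.withDensity fun x => ENNReal.ofReal (condP m μ A x)).trim hm =
      (μ.restrict A).trim hm := by
    refine @Measure.ext _ m _ _ fun s hs => ?_
    rw [trim_measurableSet_eq hm hs, trim_measurableSet_eq hm hs, withDensity_apply _ (hm s hs),
      setLIntegral_condP hm hA hs, Measure.restrict_apply (hm s hs)]
  rw [← lintegral_trim hm hg, ← htrim, lintegral_trim hm hg,
    lintegral_withDensity_eq_lintegral_mul _ hp (hg.mono hm le_rfl)]
  rfl

theorem condP_pos_ae_restrict (hm : m ≤ mX) (hA : MeasurableSet A) :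
    ∀ᵐ x ∂μ.restrict A, 0 < condP m μ A x := by
  have hs : MeasurableSet[m] {x | condP m μ A x ≤ 0} := measurable_condP A measurableSet_Iic
  have h0 : ∫⁻ x in {x | condP m μ A x ≤ 0}, ENNReal.ofReal (condP m μ A x) ∂μ = 0 := by
    rw [setLIntegral_congr_fun (hm _ hs) (g := fun _ => 0)
      fun x hx => ENNReal.ofReal_of_nonpos hx]
    simp
  rw [setLIntegral_condP hm hA hs] at h0
  rw [ae_iff, Measure.restrict_apply' hA]
  simpa only [not_lt] using h0

/-- The product formula for conditional probabilities. -/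
theorem condP_inter_fiber {J : Type*} (hA : MeasurableSet A) (b : X → J)
    (hn : n = m ⊔ MeasurableSpace.comap b ⊤) (hnX : n ≤ mX) (j : J) :
    ∀ᵐ x ∂μ.restrict (b ⁻¹' {j}), condP m μ (A ∩ b ⁻¹' {j}) x =
      condP m μ (b ⁻¹' {j}) x * condP n μ A x := by
  set B := b ⁻¹' {j} with hB
  have hmn : m ≤ n := hn ▸ le_sup_left
  have hm : m ≤ mX := hmn.trans hnX
  have hBn : MeasurableSet[n] B :=
    (hn ▸ le_sup_right : MeasurableSpace.comap b ⊤ ≤ n) _ (measurableSet_fiber b j)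
  have hBX : MeasurableSet B := hnX _ hBn
  have hu : Measurable[n] (B.indicator fun x => ENNReal.ofReal (condP m μ (A ∩ B) x)) :=
    ((measurable_ofReal_condP _).mono hmn le_rfl).indicator hBn
  have hv : Measurable[n] (B.indicator fun x =>
      ENNReal.ofReal (condP m μ B x) * ENNReal.ofReal (condP n μ A x)) :=
    (((measurable_ofReal_condP _).mono hmn le_rfl).mul (measurable_ofReal_condP _)).indicator hBn
  have key : (B.indicator fun x => ENNReal.ofReal (condP m μ (A ∩ B) x)) =ᵐ[μ]
      B.indicator fun x => ENNReal.ofReal (condP m μ B x) * ENNReal.ofReal (condP n μ A x) := by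
    refine ae_eq_of_ae_eq_trim (hm := hnX)
      (@ae_eq_of_forall_setLIntegral_eq_of_sigmaFinite _ n _ _ _ _ hu hv fun C hC _ => ?_)
    rw [setLIntegral_trim hnX hu hC, setLIntegral_trim hnX hv hC]
    obtain ⟨M, hM, hCM⟩ := exists_inter_fiber_eq b j (hn ▸ hC)
    have hMX := hm _ hM
    rw [setLIntegral_indicator hBX, setLIntegral_indicator hBX, inter_comm, hCM]
    have h1 : ∫⁻ x in M ∩ B, ENNReal.ofReal (condP m μ (A ∩ B) x) ∂μ =
        ∫⁻ x, ENNReal.ofReal (condP m μ B x) *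
          M.indicator (fun x => ENNReal.ofReal (condP m μ (A ∩ B) x)) x ∂μ := by
      rw [lintegral_condP_mul hm hBX ((measurable_ofReal_condP _).indicator hM),
        setLIntegral_indicator hMX]
    have h2 : ∫⁻ x in M ∩ B, ENNReal.ofReal (condP m μ B x) *
          ENNReal.ofReal (condP n μ A x) ∂μ =
        ∫⁻ x, ENNReal.ofReal (condP n μ A x) *
          (M ∩ B).indicator (fun x => ENNReal.ofReal (condP m μ B x)) x ∂μ := by
      rw [← lintegral_indicator (hMX.inter hBX)]
      refine lintegral_congr fun x => ?_
      rw [indicator_mul_left, mul_comm]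
    have h3 : ∫⁻ x, ENNReal.ofReal (condP m μ (A ∩ B) x) *
          M.indicator (fun x => ENNReal.ofReal (condP m μ B x)) x ∂μ =
        ∫⁻ x in M ∩ B ∩ A, ENNReal.ofReal (condP m μ B x) ∂μ := by
      rw [lintegral_condP_mul hm (hA.inter hBX) ((measurable_ofReal_condP _).indicator hM),
        setLIntegral_indicator hMX, inter_assoc, inter_comm B A]
    rw [h1, h2, lintegral_condP_mul hnX hA (((measurable_ofReal_condP _).mono hmn le_rfl).indicator
      ((hmn _ hM).inter hBn)), setLIntegral_indicator (hMX.inter hBX), ← h3]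
    refine lintegral_congr fun x => ?_
    by_cases hx : x ∈ M <;> simp [hx, mul_comm]
  rw [ae_restrict_iff' hBX]
  filter_upwards [key, condP_nonneg (m := m) (μ := μ) (A ∩ B), condP_nonneg (m := m) (μ := μ) B,
    condP_nonneg (m := n) (μ := μ) A] with x hx h1 h2 h3 hxB
  rw [indicator_of_mem hxB, indicator_of_mem hxB, ← ENNReal.ofReal_mul h2,
    ENNReal.ofReal_eq_ofReal_iff h1 (mul_nonneg h2 h3)] at hx
  exact hx

end CondP

section CondEnt

variable {X : Type*} {m n : MeasurableSpace X} [mX : MeasurableSpace X] {μ : Measure X}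

theorem condEntS_eq_tsum {I : Type*} [Countable I] (hm : m ≤ mX) (a : X → I) :
    condEntS m μ a =
      ∑' i, ∫⁻ x, ENNReal.ofReal (Real.negMulLog (condP m μ (a ⁻¹' {i}) x)) ∂μ :=
  lintegral_tsum fun _ => (Real.continuous_negMulLog.measurable.comp
    ((measurable_condP _).mono hm le_rfl)).ennreal_ofReal.aemeasurable

theorem measurable_ofReal_neg_log_condP (A : Set X) :
    Measurable[m] fun x => ENNReal.ofReal (-Real.log (condP m μ A x)) :=
  (Real.measurable_log.comp (measurable_condP A)).neg.ennreal_ofReal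

variable {I J : Type*} [Countable I] [Countable J] {a : X → I} {b : X → J}

theorem tsum_setLIntegral_inter_fiber (ha : MeasurableSpace.comap a ⊤ ≤ mX) {B : Set X}
    (hB : MeasurableSet B) (g : X → ℝ≥0∞) :
    ∑' i, ∫⁻ x in a ⁻¹' {i} ∩ B, g x ∂μ = ∫⁻ x in B, g x ∂μ := by
  rw [← lintegral_iUnion (fun i => (ha _ (measurableSet_fiber a i)).inter hB), ← iUnion_inter,
    ← preimage_iUnion, iUnion_of_singleton, preimage_univ, univ_inter]
  intro i j hij
  refine Disjoint.mono inter_subset_left inter_subset_left (Disjoint.preimage a ?_)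
  simpa using hij

theorem condEntS_swap : condEntS m μ (fun x => (a x, b x)) = condEntS m μ fun x => (b x, a x) := by
  unfold condEntS
  refine lintegral_congr fun x => ?_
  rw [← (Equiv.prodComm I J).tsum_eq]
  refine tsum_congr fun q => ?_
  have : (fun x => (b x, a x)) ⁻¹' {Equiv.prodComm I J q} = (fun x => (a x, b x)) ⁻¹' {q} := by
    ext x; simp [Prod.ext_iff, and_comm]
  rw [this]

variable [IsProbabilityMeasure μ]

/-- Conditional entropy as the integral of the conditional information function. -/
theorem condEntS_eq_tsum_setLIntegral (hm : m ≤ mX) (ha : MeasurableSpace.comap a ⊤ ≤ mX) :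
    condEntS m μ a =
      ∑' i, ∫⁻ x in a ⁻¹' {i}, ENNReal.ofReal (-Real.log (condP m μ (a ⁻¹' {i}) x)) ∂μ := by
  rw [condEntS_eq_tsum hm]
  refine tsum_congr fun i => ?_
  rw [← lintegral_condP_mul hm (ha _ (measurableSet_fiber a i))
    (measurable_ofReal_neg_log_condP _)]
  refine lintegral_congr_ae ?_
  filter_upwards [condP_nonneg (m := m) (μ := μ) (a ⁻¹' {i})] with x hx
  rw [← ENNReal.ofReal_mul hx, Real.negMulLog, neg_mul, mul_neg]

theorem negMulLog_condP_nonneg (hm : m ≤ mX) {A : Set X} (hA : MeasurableSet A) :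
    ∀ᵐ x ∂μ, 0 ≤ Real.negMulLog (condP m μ A x) := by
  filter_upwards [condP_nonneg (m := m) (μ := μ) A, condP_le_one hm hA] with x h0 h1
  exact Real.negMulLog_nonneg h0 h1

theorem integrable_negMulLog_condP (hm : m ≤ mX) {A : Set X} (hA : MeasurableSet A) :
    Integrable (fun x => Real.negMulLog (condP m μ A x)) μ := by
  refine Integrable.of_bound (C := 1) (Real.continuous_negMulLog.measurable.comp
    ((measurable_condP A).mono hm le_rfl)).aestronglyMeasurable ?_
  filter_upwards [condP_nonneg (m := m) (μ := μ) A, negMulLog_condP_nonneg hm hA] with x h0 h1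
  rw [Real.norm_of_nonneg h1]
  linarith [Real.negMulLog_le_one_sub_self h0]

theorem lintegral_negMulLog_condP_anti (hmn : m ≤ n) (hn : n ≤ mX) {A : Set X}
    (hA : MeasurableSet A) :
    ∫⁻ x, ENNReal.ofReal (Real.negMulLog (condP n μ A x)) ∂μ ≤
      ∫⁻ x, ENNReal.ofReal (Real.negMulLog (condP m μ A x)) ∂μ := by
  have hm := hmn.trans hn
  have hjensen := Real.concaveOn_negMulLog.condExp_map_le hm
    (Real.continuous_negMulLog.upperSemicontinuous.upperSemicontinuousOn _)
    (condP_nonneg (m := n) (μ := μ) A) isClosed_Ici (integrable_condP A)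
    (integrable_negMulLog_condP hn hA)
  have htower : μ[condP n μ A | m] =ᵐ[μ] condP m μ A := condExp_condExp_of_le hmn hn
  rw [← ofReal_integral_eq_lintegral_ofReal (integrable_negMulLog_condP hn hA) 
      (negMulLog_condP_nonneg hn hA),
    ← ofReal_integral_eq_lintegral_ofReal (integrable_negMulLog_condP hm hA) 
      (negMulLog_condP_nonneg hm hA)]
  refine ENNReal.ofReal_le_ofReal ?_
  rw [← integral_condExp hm]
  refine integral_mono_ae integrable_condExp (integrable_negMulLog_condP hm hA) ?_
  filter_upwards [hjensen, htower] with x h1 h2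
  rwa [Function.comp_apply, h2] at h1

/-- Conditioning on a finer σ-algebra decreases entropy. -/
theorem condEntS_anti (hmn : m ≤ n) (hn : n ≤ mX) (ha : MeasurableSpace.comap a ⊤ ≤ mX) :
    condEntS n μ a ≤ condEntS m μ a := by
  rw [condEntS_eq_tsum hn, condEntS_eq_tsum (hmn.trans hn)]
  exact ENNReal.tsum_le_tsum fun i =>
    lintegral_negMulLog_condP_anti hmn hn (ha _ (measurableSet_fiber a i))

theorem condEntS_bot (ha : MeasurableSpace.comap a ⊤ ≤ mX) : condEntS ⊥ μ a = Hpart μ a := by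
  rw [condEntS_eq_tsum bot_le, Hpart]
  refine tsum_congr fun i => ?_
  rw [condP, condExp_bot, integral_indicator (ha _ (measurableSet_fiber a i))]
  simp [Measure.real]

theorem condEntS_le_Hpart (hm : m ≤ mX) (ha : MeasurableSpace.comap a ⊤ ≤ mX) :
    condEntS m μ a ≤ Hpart μ a :=
  (condEntS_anti bot_le hm ha).trans_eq (condEntS_bot ha)

theorem condEntS_eq_zero (hm : m ≤ mX) (ha : MeasurableSpace.comap a ⊤ ≤ m) :
    condEntS m μ a = 0 := by
  rw [condEntS_eq_tsum hm, ENNReal.tsum_eq_zero]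
  intro i
  have hA : MeasurableSet[m] (a ⁻¹' {i}) := ha _ (measurableSet_fiber a i)
  rw [condP, condExp_of_stronglyMeasurable hm (stronglyMeasurable_const.indicator hA)
    (integrable_indicator_one (hm _ hA))]
  refine (lintegral_congr fun x => ?_).trans lintegral_zero
  by_cases hx : x ∈ a ⁻¹' {i}
  · rw [indicator_of_mem hx]; simp
  · rw [indicator_of_notMem hx]; simp

theorem comap_prodMk_le (ha : MeasurableSpace.comap a ⊤ ≤ mX)
    (hb : MeasurableSpace.comap b ⊤ ≤ mX) :
    MeasurableSpace.comap (fun x => (a x, b x)) ⊤ ≤ mX := by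
  rintro _ ⟨t, -, rfl⟩
  have : (fun x => (a x, b x)) ⁻¹' t = ⋃ q ∈ t, (a ⁻¹' {q.1} ∩ b ⁻¹' {q.2}) := by
    ext x
    simp only [mem_preimage, mem_iUnion, mem_inter_iff, mem_singleton_iff, exists_prop]
    constructor
    · exact fun hx => ⟨_, hx, rfl, rfl⟩
    · rintro ⟨⟨i, j⟩, hq, rfl, rfl⟩
      exact hq
  rw [this]
  exact MeasurableSet.biUnion t.to_countable fun q _ =>
    (ha _ (measurableSet_fiber a _)).inter (hb _ (measurableSet_fiber b _))

/-- The chain rule for conditional entropy. -/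
theorem condEntS_prodMk (ha : MeasurableSpace.comap a ⊤ ≤ mX)
    (hn : n = m ⊔ MeasurableSpace.comap b ⊤) (hnX : n ≤ mX) :
    condEntS m μ (fun x => (a x, b x)) = condEntS m μ b + condEntS n μ a := by
  have hmn : m ≤ n := hn ▸ le_sup_left
  have hm : m ≤ mX := hmn.trans hnX
  have hb : MeasurableSpace.comap b ⊤ ≤ mX :=
    (hn ▸ le_sup_right : MeasurableSpace.comap b ⊤ ≤ n).trans hnX
  have hA : ∀ i, MeasurableSet (a ⁻¹' {i}) := fun i => ha _ (measurableSet_fiber a i)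
  have hB : ∀ j, MeasurableSet (b ⁻¹' {j}) := fun j => hb _ (measurableSet_fiber b j)
  rw [condEntS_eq_tsum_setLIntegral hm (comap_prodMk_le ha hb),
    condEntS_eq_tsum_setLIntegral hm hb, condEntS_eq_tsum_setLIntegral hnX ha]
  have hcell : ∀ q : I × J, (fun x => (a x, b x)) ⁻¹' {q} = a ⁻¹' {q.1} ∩ b ⁻¹' {q.2} := by
    intro q; ext x; simp [Prod.ext_iff]
  have hterm : ∀ i j, ∫⁻ x in a ⁻¹' {i} ∩ b ⁻¹' {j},
        ENNReal.ofReal (-Real.log (condP m μ (a ⁻¹' {i} ∩ b ⁻¹' {j}) x)) ∂μ =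
      (∫⁻ x in a ⁻¹' {i} ∩ b ⁻¹' {j}, ENNReal.ofReal (-Real.log (condP m μ (b ⁻¹' {j}) x)) ∂μ) +
      ∫⁻ x in a ⁻¹' {i} ∩ b ⁻¹' {j}, ENNReal.ofReal (-Real.log (condP n μ (a ⁻¹' {i}) x)) ∂μ := by
    intro i j
    rw [← lintegral_add_left ((measurable_ofReal_neg_log_condP _).mono hm le_rfl)]
    refine lintegral_congr_ae ?_
    filter_upwards [ae_restrict_of_ae_restrict_of_subset inter_subset_left
        (condP_pos_ae_restrict (μ := μ) hnX (hA i)),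
      ae_restrict_of_ae_restrict_of_subset inter_subset_right
        (condP_pos_ae_restrict (μ := μ) hm (hB j)),
      ae_restrict_of_ae_restrict_of_subset inter_subset_right
        (condP_inter_fiber (μ := μ) (hA i) b hn hnX j),
      ae_restrict_of_ae (condP_le_one (μ := μ) hnX (hA i)),
      ae_restrict_of_ae (condP_le_one (μ := μ) hm (hB j))] with x h1 h2 h3 h4 h5
    rw [h3, Real.log_mul h2.ne' h1.ne', neg_add, ENNReal.ofReal_add]
    · exact neg_nonneg.2 (Real.log_nonpos h2.le h5)
    · exact neg_nonneg.2 (Real.log_nonpos h1.le h4)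
  simp only [hcell]
  rw [ENNReal.tsum_prod']
  simp only [hterm, ENNReal.tsum_add]
  congr 1
  · rw [ENNReal.tsum_comm]
    exact tsum_congr fun j => tsum_setLIntegral_inter_fiber ha (hB j) _
  · refine tsum_congr fun i => ?_
    simp only [inter_comm (a ⁻¹' {i})]
    exact tsum_setLIntegral_inter_fiber hb (hA i) _

/-- The chain rule, with the joint partition replaced by any partition `c` equivalent to it. -/
theorem condEntS_eq_add {K : Type*} [Countable K] {c : X → K}
    (hn : n = m ⊔ MeasurableSpace.comap b ⊤) (hnX : n ≤ mX)
    (hac : MeasurableSpace.comap a ⊤ ≤ MeasurableSpace.comap c ⊤)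
    (hbc : MeasurableSpace.comap b ⊤ ≤ MeasurableSpace.comap c ⊤)
    (hc : MeasurableSpace.comap c ⊤ ≤ mX)
    (hcab : MeasurableSpace.comap c ⊤ ≤ MeasurableSpace.comap (fun x => (a x, b x)) ⊤) :
    condEntS m μ c = condEntS m μ b + condEntS n μ a := by
  have hm : m ≤ mX := (hn ▸ le_sup_left : m ≤ n).trans hnX
  have hle : MeasurableSpace.comap (fun x => (a x, b x)) ⊤ ≤ MeasurableSpace.comap c ⊤ :=
    @comap_prodMk_le X (MeasurableSpace.comap c ⊤) I J _ _ a b hac hbc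
  rw [← condEntS_prodMk (hac.trans hc) hn hnX]
  have h1 := condEntS_prodMk (μ := μ) (a := c) (b := fun x => (a x, b x)) (m := m) hc rfl
    (sup_le hm (hle.trans hc))
  have h2 := condEntS_prodMk (μ := μ) (a := fun x => (a x, b x)) (b := c) (m := m)
    (hle.trans hc) rfl (sup_le hm hc)
  rw [condEntS_eq_zero (sup_le hm (hle.trans hc)) (hcab.trans le_sup_right), add_zero] at h1
  rw [condEntS_eq_zero (sup_le hm hc) (hle.trans le_sup_right), add_zero] at h2
  rw [← h1, ← h2, condEntS_swap]

theorem condP_preimage (hm : m ≤ mX) (e : X ≃ᵐ X) (he : MeasurePreserving e μ μ)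
    (hem : ∀ s, MeasurableSet[m] s → MeasurableSet[m] (e ⁻¹' s))
    (hem' : ∀ s, MeasurableSet[m] s → MeasurableSet[m] (e.symm ⁻¹' s)) {A : Set X}
    (hA : MeasurableSet A) :
    (fun x => condP m μ A (e x)) =ᵐ[μ] condP m μ (e ⁻¹' A) := by
  have hmeas : Measurable[m] fun x => condP m μ A (e x) := by
    intro t ht
    exact hem _ (measurable_condP A ht)
  refine ae_eq_condExp_of_forall_setIntegral_eq hm (integrable_indicator_one (e.measurable hA))
    (fun s _ _ => ((he.integrable_comp_emb e.measurableEmbedding).2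
      (integrable_condP A)).integrableOn) (fun s hs _ => ?_)
    hmeas.stronglyMeasurable.aestronglyMeasurable
  have hs' : s = e ⁻¹' (e.symm ⁻¹' s) := by ext x; simp
  rw [hs', he.setIntegral_preimage_emb e.measurableEmbedding, condP,
    setIntegral_condExp hm (integrable_indicator_one hA) (hem' s hs),
    ← he.setIntegral_preimage_emb e.measurableEmbedding]
  rfl

/-- Conditional entropy is invariant under automorphisms preserving the σ-algebra. -/
theorem condEntS_comp (hm : m ≤ mX) (e : X ≃ᵐ X) (he : MeasurePreserving e μ μ)
    (hem : ∀ s, MeasurableSet[m] s → MeasurableSet[m] (e ⁻¹' s))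
    (hem' : ∀ s, MeasurableSet[m] s → MeasurableSet[m] (e.symm ⁻¹' s))
    (ha : MeasurableSpace.comap a ⊤ ≤ mX) :
    condEntS m μ (fun x => a (e x)) = condEntS m μ a := by
  rw [condEntS_eq_tsum hm, condEntS_eq_tsum hm]
  refine tsum_congr fun i => ?_
  refine Eq.trans (lintegral_congr_ae ?_) (he.lintegral_comp_emb e.measurableEmbedding
    fun x => ENNReal.ofReal (Real.negMulLog (condP m μ (a ⁻¹' {i}) x)))
  filter_upwards [condP_preimage hm e he hem hem' (ha _ (measurableSet_fiber a i))] with x hx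
  rw [hx]
  rfl

end CondEnt

theorem comap_top_le_comap_top {X I J : Type*} {f : X → I} {g : X → J}
    (h : ∀ x y, g x = g y → f x = f y) :
    MeasurableSpace.comap f ⊤ ≤ MeasurableSpace.comap g ⊤ := by
  rintro _ ⟨t, -, rfl⟩
  refine ⟨g '' (f ⁻¹' t), trivial, ?_⟩
  ext x
  simp only [mem_preimage, mem_image]
  constructor
  · rintro ⟨y, hy, hyx⟩
    rwa [h x y hyx.symm]
  · exact fun hx => ⟨x, hx, rfl⟩

theorem comap_top_le_of_measurable {X I : Type*} [MeasurableSpace X] [Countable I]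
    [MeasurableSpace I] [MeasurableSingletonClass I] {f : X → I} (hf : Measurable f) :
    MeasurableSpace.comap f ⊤ ≤ ‹MeasurableSpace X› := by
  rintro _ ⟨t, -, rfl⟩
  exact hf t.to_countable.measurableSet

section Partition

variable {X : Type*} {m : MeasurableSpace X} [mX : MeasurableSpace X] {μ : Measure X}
  [IsProbabilityMeasure μ] {I J K : Type*} [Countable I] [Countable J] [Countable K] {a : X → I}
  {b : X → J} {c : X → K}

theorem condEntS_eq_add_of_iff (hm : m ≤ mX) (hc : MeasurableSpace.comap c ⊤ ≤ mX)
    (h : ∀ x y, c x = c y ↔ a x = a y ∧ b x = b y) :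
    condEntS m μ c = condEntS m μ b + condEntS (m ⊔ MeasurableSpace.comap b ⊤) μ a := by
  have hb : MeasurableSpace.comap b ⊤ ≤ MeasurableSpace.comap c ⊤ :=
    comap_top_le_comap_top fun x y hxy => ((h x y).1 hxy).2
  exact condEntS_eq_add rfl (sup_le hm (hb.trans hc))
    (comap_top_le_comap_top fun x y hxy => ((h x y).1 hxy).1) hb hc
    (comap_top_le_comap_top fun x y hxy => (h x y).2 (Prod.ext_iff.1 hxy))

theorem condEntS_of_const (hm : m ≤ mX) (hc : ∀ x y, c x = c y) : condEntS m μ c = 0 := by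
  refine condEntS_eq_zero hm (le_trans (comap_top_le_comap_top
    (g := fun _ : X => ()) fun x y _ => hc x y) ?_)
  rw [MeasurableSpace.comap_const]
  exact bot_le

theorem condEntS_congr (hm : m ≤ mX) (hc : MeasurableSpace.comap c ⊤ ≤ mX)
    (h : ∀ x y, c x = c y ↔ a x = a y) : condEntS m μ c = condEntS m μ a := by
  rw [condEntS_eq_add_of_iff (b := fun _ : X => ()) (a := a) hm hc fun x y => by simp [h],
    condEntS_of_const hm fun _ _ => rfl, zero_add, MeasurableSpace.comap_const, sup_bot_eq]

end Partition

namespace BorelAction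

variable {G X I : Type*} [Group G] [mX : MeasurableSpace X] (T : BorelAction G X)

theorem joinF_eq_iff {F : Set G} {a : X → I} {x y : X} :
    T.joinF F a x = T.joinF F a y ↔ ∀ g ∈ F, a (T.act g⁻¹ x) = a (T.act g⁻¹ y) := by
  simp [joinF, funext_iff]

theorem joinF_act_eq_iff {F : Set G} {a : X → I} {g : G} {x y : X} :
    T.joinF F a (T.act g⁻¹ x) = T.joinF F a (T.act g⁻¹ y) ↔
      T.joinF (g • F) a x = T.joinF (g • F) a y := by
  simp only [joinF_eq_iff, ← T.act_mul, ← mul_inv_rev]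
  constructor
  · rintro h _ ⟨f, hf, rfl⟩
    exact h f hf
  · exact fun h f hf => h _ (smul_mem_smul_set hf)

/-- The automorphism by which a group element acts. -/
def equiv (g : G) : X ≃ᵐ X where
  toFun := T.act g
  invFun := T.act g⁻¹
  left_inv x := by rw [← T.act_mul, inv_mul_cancel, T.act_one]
  right_inv x := by rw [← T.act_mul, mul_inv_cancel, T.act_one]
  measurable_toFun := T.measurable_act g
  measurable_invFun := T.measurable_act g⁻¹

theorem comap_joinF_le [MeasurableSpace I] [MeasurableSingletonClass I] [Countable I] {a : X → I}
    (ha : Measurable a) (F : Set G) [Finite F] : MeasurableSpace.comap (T.joinF F a) ⊤ ≤ mX :=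
  comap_top_le_of_measurable (measurable_pi_lambda _ fun _ => ha.comp (T.measurable_act _))

end BorelAction

/-- The entropy given `m` of the join of the translates of the partition `a` over a finite set. -/
noncomputable def joinEnt {G X I : Type*} [Group G] [Countable I] (m : MeasurableSpace X)
    [mX : MeasurableSpace X] (μ : Measure X) (T : BorelAction G X) (a : X → I) (E : Finset G) :
    ℝ≥0∞ :=
  condEntS m μ (T.joinF (E : Set G) a)

section JoinEnt

variable {G X I : Type*} [Group G] [Countable I] [MeasurableSpace I] [MeasurableSingletonClass I]
  {m : MeasurableSpace X} [mX : MeasurableSpace X] {μ : Measure X} [IsProbabilityMeasure μ]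
  {T : BorelAction G X} {a : X → I}

theorem joinEnt_eq_of_iff {J : Type*} [Countable J] {c : X → J} (hm : m ≤ mX) (ha : Measurable a)
    (E : Finset G) (h : ∀ x y, T.joinF (E : Set G) a x = T.joinF (E : Set G) a y ↔ c x = c y) :
    joinEnt m μ T a E = condEntS m μ c :=
  condEntS_congr hm (T.comap_joinF_le ha _) h

theorem condEntS_act {J : Type*} [Countable J] {c : X → J} (hm : InvariantSA m T)
    (hT : T.Preserves μ) (hc : MeasurableSpace.comap c ⊤ ≤ mX) (g : G) :
    condEntS m μ (fun x => c (T.act g x)) = condEntS m μ c :=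
  condEntS_comp hm.1 (T.equiv g) (hT g) (hm.2 g) (hm.2 g⁻¹) hc

variable [DecidableEq G]

theorem joinEnt_smul (hm : InvariantSA m T) (hT : T.Preserves μ) (ha : Measurable a) (g : G)
    (E : Finset G) : joinEnt m μ T a (g • E) = joinEnt m μ T a E := by
  rw [joinEnt_eq_of_iff (c := fun x => T.joinF (E : Set G) a (T.act g⁻¹ x)) hm.1 ha]
  · exact condEntS_act hm hT (T.comap_joinF_le ha _) g⁻¹
  · intro x y
    rw [T.joinF_act_eq_iff, Finset.coe_smul_finset]

/-- The chain rule, for joins of translates of a partition. -/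
theorem joinEnt_union {J : Type*} [Countable J] {c : X → J} (hm : m ≤ mX) (ha : Measurable a)
    (E D : Finset G)
    (h : ∀ x y, T.joinF (D : Set G) a x = T.joinF (D : Set G) a y ↔ c x = c y) :
    joinEnt m μ T a (E ∪ D) = joinEnt m μ T a D +
      condEntS (m ⊔ MeasurableSpace.comap c ⊤) μ (T.joinF (E : Set G) a) := by
  rw [joinEnt_eq_of_iff hm ha D h]
  refine condEntS_eq_add_of_iff hm (T.comap_joinF_le ha _) fun x y => ?_
  rw [← h]
  simp only [T.joinF_eq_iff, Finset.coe_union, mem_union, or_imp, forall_and]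

theorem joinEnt_union_le (hm : m ≤ mX) (ha : Measurable a) (E D : Finset G) :
    joinEnt m μ T a (E ∪ D) ≤ joinEnt m μ T a D + joinEnt m μ T a E := by
  rw [joinEnt_union hm ha E D fun _ _ => Iff.rfl]
  exact add_le_add_right (condEntS_anti le_sup_left (sup_le hm (T.comap_joinF_le ha _))
    (T.comap_joinF_le ha _)) _

theorem joinEnt_ne_top (hm : InvariantSA m T) (hT : T.Preserves μ) (ha : Measurable a)
    (hent : Hpart μ a < ⊤) (E : Finset G) : joinEnt m μ T a E ≠ ⊤ := by
  induction E using Finset.induction_on with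
  | empty =>
    rw [joinEnt, condEntS_of_const hm.1 fun x y => T.joinF_eq_iff.2 (by simp)]
    exact ENNReal.zero_ne_top
  | insert g E _ ih =>
    rw [Finset.insert_eq]
    refine ne_top_of_le_ne_top (ENNReal.add_ne_top.2 ⟨ih, ?_⟩) (joinEnt_union_le hm.1 ha {g} E)
    rw [joinEnt_eq_of_iff (c := fun x => a (T.act g⁻¹ x)) hm.1 ha,
      condEntS_act hm hT (comap_top_le_of_measurable ha)]
    · exact ((condEntS_le_Hpart hm.1 (comap_top_le_of_measurable ha)).trans_lt hent).ne
    · intro x y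
      simp [T.joinF_eq_iff]

end JoinEnt

/-- The conditional entropy of `B_n · a` given `m` and its translates by `s⁻¹, …, s⁻ᵏ`. -/
noncomputable def orbitEnt {r : ℕ} {X : Type*} (m : MeasurableSpace X) [mX : MeasurableSpace X]
    (μ : Measure X) (T : BorelAction (FG r) X) (a : X → ℕ) (s : FG r) (n k : ℕ) : ℝ≥0∞ :=
  condEntS (m ⊔ MeasurableSpace.comap (fun x (mm : Fin k) =>
    T.joinF (ball r n) a (T.act (s ^ (mm.1 + 1)) x)) ⊤) μ (T.joinF (ball r n) a)

section FreeGroup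

variable {r : ℕ} {X : Type*} {m : MeasurableSpace X} [mX : MeasurableSpace X] {μ : Measure X}
  [IsProbabilityMeasure μ] {T : BorelAction (FG r) X} {a : X → ℕ}

theorem invSubmodular_joinEnt (hm : InvariantSA m T) (hT : T.Preserves μ) (ha : Measurable a)
    (hent : Hpart μ a < ⊤) : InvSubmodular fun E => (joinEnt m μ T a E).toReal where
  union_add_le E D D' hD := by
    have hfin := joinEnt_ne_top hm hT ha hent
    rw [← ENNReal.toReal_add (hfin _) (hfin _), ← ENNReal.toReal_add (hfin _) (hfin _)]
    refine ENNReal.toReal_mono (ENNReal.add_ne_top.2 ⟨hfin _, hfin _⟩) ?_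
    rw [joinEnt_union hm.1 ha E D fun _ _ => Iff.rfl,
      joinEnt_union hm.1 ha E D' fun _ _ => Iff.rfl]
    have hDD : MeasurableSpace.comap (T.joinF (D' : Set (FG r)) a) ⊤ ≤
        MeasurableSpace.comap (T.joinF (D : Set (FG r)) a) ⊤ :=
      comap_top_le_comap_top fun x y hxy => T.joinF_eq_iff.2 fun g hg =>
        T.joinF_eq_iff.1 hxy g (hD hg)
    calc _ ≤ joinEnt m μ T a D +
            condEntS (m ⊔ MeasurableSpace.comap (T.joinF (D' : Set (FG r)) a) ⊤) μ
              (T.joinF (E : Set (FG r)) a) + joinEnt m μ T a D' := by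
          gcongr
          exact condEntS_anti (sup_le_sup_left hDD m) (sup_le hm.1 (T.comap_joinF_le ha _))
            (T.comap_joinF_le ha _)
      _ = _ := by ring
  smul_eq g E := by rw [joinEnt_smul hm hT ha]

theorem condEntS_joinF_ball (hm : m ≤ mX) (ha : Measurable a) (n : ℕ) :
    condEntS m μ (T.joinF (ball r n) a) = joinEnt m μ T a (ballFinset r n) :=
  (joinEnt_eq_of_iff hm ha _ fun x y => by simp only [T.joinF_eq_iff, coe_ballFinset]).symm

theorem fSeqRel_eq_setF (hm : m ≤ mX) (ha : Measurable a) (n : ℕ) :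
    fSeqRel m μ T a n = setF (fun E => (joinEnt m μ T a E).toReal) (ballFinset r n) := by
  unfold fSeqRel FFrel setF
  rw [condEntS_joinF_ball hm ha]
  congr 1
  refine Finset.sum_congr rfl fun i _ => ?_
  refine congrArg ENNReal.toReal (joinEnt_eq_of_iff hm ha _ fun x y => ?_).symm
  simp only [Prod.ext_iff, BorelAction.tr, T.joinF_act_eq_iff]
  simp only [T.joinF_eq_iff, Finset.coe_union, Finset.coe_smul_finset, coe_ballFinset, mem_union,
    or_imp, forall_and]

theorem joinF_smul_line_eq_iff (s : FG r) (n k : ℕ) (x y : X) :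
    T.joinF ((s⁻¹ • line s (ballFinset r n) k : Finset (FG r)) : Set (FG r)) a x =
        T.joinF ((s⁻¹ • line s (ballFinset r n) k : Finset (FG r)) : Set (FG r)) a y ↔
      (fun mm : Fin k => T.joinF (ball r n) a (T.act (s ^ (mm.1 + 1)) x)) =
        fun mm : Fin k => T.joinF (ball r n) a (T.act (s ^ (mm.1 + 1)) y) := by
  simp only [funext_iff (f := fun mm : Fin k => T.joinF (ball r n) a _)]
  simp only [T.joinF_eq_iff, Finset.coe_smul_finset, line, Finset.coe_biUnion, Finset.coe_range,
    ← T.act_mul, coe_ballFinset]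
  constructor
  · intro h mm g hg
    have := h (s⁻¹ • (s ^ mm.1)⁻¹ • g) (smul_mem_smul_set (mem_biUnion (mem_Iio.2 mm.2)
      (smul_mem_smul_set hg)))
    simpa only [smul_eq_mul, mul_inv_rev, inv_inv, mul_assoc, ← pow_succ] using this
  · rintro h _ ⟨_, hz, rfl⟩
    obtain ⟨j, hj, g, hg, rfl⟩ := mem_iUnion₂.1 hz
    have := h ⟨j, hj⟩ g hg
    simpa only [smul_eq_mul, mul_inv_rev, inv_inv, mul_assoc, ← pow_succ] using this

theorem comap_orbit_le (ha : Measurable a) (s : FG r) (n k : ℕ) :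
    MeasurableSpace.comap (fun x (mm : Fin k) =>
      T.joinF (ball r n) a (T.act (s ^ (mm.1 + 1)) x)) ⊤ ≤ mX :=
  (comap_top_le_comap_top fun x y => (joinF_smul_line_eq_iff s n k x y).1).trans
    (T.comap_joinF_le ha _)

theorem joinEnt_line_succ (hm : InvariantSA m T) (hT : T.Preserves μ) (ha : Measurable a)
    (s : FG r) (n k : ℕ) :
    joinEnt m μ T a (line s (ballFinset r n) (k + 1)) =
      joinEnt m μ T a (line s (ballFinset r n) k) + orbitEnt m μ T a s n k := by
  rw [orbitEnt, condEntS_joinF_ball (sup_le hm.1 (comap_orbit_le ha s n k)) ha, line_succ,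
    joinEnt_union hm.1 ha _ _ (joinF_smul_line_eq_iff s n k), joinEnt_smul hm hT ha]
  rfl

theorem antitone_orbitEnt (hm : m ≤ mX) (ha : Measurable a) (s : FG r) (n : ℕ) :
    Antitone (orbitEnt m μ T a s n) := by
  intro k l hkl
  refine condEntS_anti (sup_le_sup_left ?_ m) (sup_le hm (comap_orbit_le ha s n l))
    (T.comap_joinF_le ha _)
  exact comap_top_le_comap_top fun x y hxy =>
    funext fun mm => congrFun hxy (Fin.castLE hkl mm)

theorem orbitEnt_ne_top (hm : InvariantSA m T) (hT : T.Preserves μ) (ha : Measurable a)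
    (hent : Hpart μ a < ⊤) (s : FG r) (n k : ℕ) : orbitEnt m μ T a s n k ≠ ⊤ :=
  ne_top_of_le_ne_top (joinEnt_ne_top hm hT ha hent _)
    ((joinEnt_line_succ hm hT ha s n k).symm ▸ le_add_self)

theorem toReal_orbitEnt (hm : InvariantSA m T) (hT : T.Preserves μ) (ha : Measurable a)
    (hent : Hpart μ a < ⊤) (s : FG r) (n k : ℕ) :
    (orbitEnt m μ T a s n k).toReal = (joinEnt m μ T a (line s (ballFinset r n) (k + 1))).toReal -
      (joinEnt m μ T a (line s (ballFinset r n) k)).toReal := by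
  rw [joinEnt_line_succ hm hT ha, ENNReal.toReal_add (joinEnt_ne_top hm hT ha hent _)
    (orbitEnt_ne_top hm hT ha hent s n k), add_sub_cancel_left]

theorem tendsto_toReal_orbitEnt (hm : InvariantSA m T) (hT : T.Preserves μ) (ha : Measurable a)
    (hent : Hpart μ a < ⊤) (s : FG r) (n : ℕ) :
    Tendsto (fun k => (orbitEnt m μ T a s n k).toReal) atTop
      (nhds (⨅ k, orbitEnt m μ T a s n k).toReal) :=
  (ENNReal.tendsto_toReal (ne_top_of_le_ne_top (orbitEnt_ne_top hm hT ha hent s n 0)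
    (iInf_le _ 0))).comp (tendsto_atTop_iInf (antitone_orbitEnt hm.1 ha s n))

theorem orbitEnt_sum_le_fSeqRel (hm : InvariantSA m T) (hT : T.Preserves μ) (ha : Measurable a)
    (hent : Hpart μ a < ⊤) (n : ℕ) :
    (1 - (r : ℝ)) * (joinEnt m μ T a (ballFinset r n)).toReal +
      ∑ i : Fin r, (⨅ k, orbitEnt m μ T a (FreeGroup.of i) n k).toReal ≤ fSeqRel m μ T a n := by
  have hterm : ∀ i : Fin r, (⨅ k, orbitEnt m μ T a (FreeGroup.of i) n k).toReal ≤
      (joinEnt m μ T a (FreeGroup.of i • ballFinset r n ∪ ballFinset r n)).toReal -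
        (joinEnt m μ T a (ballFinset r n)).toReal := by
    intro i
    refine (ENNReal.toReal_mono (orbitEnt_ne_top hm hT ha hent _ n 1) (iInf_le _ 1)).trans_eq ?_
    rw [toReal_orbitEnt hm hT ha hent, line_succ, line_one,
      ← joinEnt_smul hm hT ha (FreeGroup.of i) (ballFinset r n ∪ _), Finset.smul_finset_union,
      smul_inv_smul]
  rw [fSeqRel_eq_setF hm.1 ha, setF]
  have hsum := Finset.sum_le_sum fun i (_ : i ∈ Finset.univ) => hterm i
  rw [Finset.sum_sub_distrib, Finset.sum_const, Finset.card_univ, Fintype.card_fin,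
    nsmul_eq_mul] at hsum
  linarith

theorem fInvRel_le_orbitEnt_sum (hm : InvariantSA m T) (hT : T.Preserves μ) (ha : Measurable a)
    (hent : Hpart μ a < ⊤) (n : ℕ) :
    fInvRel m μ T a ≤ (((1 - (r : ℝ)) * (joinEnt m μ T a (ballFinset r n)).toReal +
      ∑ i : Fin r, (⨅ k, orbitEnt m μ T a (FreeGroup.of i) n k).toReal : ℝ) : EReal) := by
  have hlim : Tendsto (fun k => (1 - (r : ℝ)) * (joinEnt m μ T a (ballFinset r n)).toReal +
      ∑ i : Fin r, (orbitEnt m μ T a (FreeGroup.of i) n (k + 1)).toReal) atTop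
      (nhds ((1 - (r : ℝ)) * (joinEnt m μ T a (ballFinset r n)).toReal +
        ∑ i : Fin r, (⨅ k, orbitEnt m μ T a (FreeGroup.of i) n k).toReal)) :=
    (tendsto_finsetSum _ fun i _ => (tendsto_toReal_orbitEnt hm hT ha hent _ n).comp
      (tendsto_add_atTop_nat 1)).const_add _
  refine ge_of_tendsto' ((continuous_coe_real_ereal.tendsto _).comp hlim) fun k => ?_
  obtain ⟨N, hN⟩ := (invSubmodular_joinEnt hm hT ha hent).exists_setF_ballFinset_le_line
    (ballFinset r n) (one_mem_ballFinset r n) k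
  refine (iInf_le _ N).trans (EReal.coe_le_coe_iff.2 ?_)
  rw [fSeqRel_eq_setF hm.1 ha]
  simpa only [toReal_orbitEnt hm hT ha hent] using hN

theorem tendsto_fSeqRel (hm : InvariantSA m T) (hT : T.Preserves μ) (ha : Measurable a)
    (hent : Hpart μ a < ⊤) :
    Tendsto (fun n => ((fSeqRel m μ T a n : ℝ) : EReal)) atTop (nhds (fInvRel m μ T a)) := by
  refine tendsto_atTop_iInf fun k l hkl => EReal.coe_le_coe_iff.2 ?_
  rw [fSeqRel_eq_setF hm.1 ha, fSeqRel_eq_setF hm.1 ha]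
  exact (invSubmodular_joinEnt hm hT ha hent).antitone_setF_ballFinset hkl

end FreeGroup

/-- Bowen's formula for relative f-invariant entropy via relative
Kolmogorov–Sinai entropies of the generators. -/
theorem statement14 {r : ℕ} (hr : 1 ≤ r) {X : Type*}
    (m : MeasurableSpace X) [mX : MeasurableSpace X] [StandardBorelSpace X]
    (μ : Measure X) [IsProbabilityMeasure μ]
    (T : BorelAction (FG r) X) (hT : T.Preserves μ)
    (hm : InvariantSA m T)
    (a : X → ℕ) (ha : Measurable a) (hgen : T.Generating a μ) (hent : Hpart μ a < ⊤) :
    Filter.Tendsto (fun n : ℕ =>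
        (((1 - (r : ℝ)) * (condEntS m μ (T.joinF (ball r n) a)).toReal
          + ∑ i : Fin r,
            (⨅ k : ℕ, condEntS
                (m ⊔ MeasurableSpace.comap
                  (fun x (mm : Fin k) =>
                    T.joinF (ball r n) a (T.act (FreeGroup.of i ^ (mm.1 + 1)) x)) ⊤)
                μ (T.joinF (ball r n) a)).toReal : ℝ) : EReal))
      Filter.atTop (nhds (fInvRel m μ T a)) := by
  simp only [condEntS_joinF_ball (μ := μ) hm.1 ha]
  exact tendsto_of_tendsto_of_tendsto_of_le_of_le tendsto_const_nhds
    (tendsto_fSeqRel hm hT ha hent) (fInvRel_le_orbitEnt_sum hm hT ha hent)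
    fun n => EReal.coe_le_coe_iff.2 (orbitEnt_sum_le_fSeqRel hm hT ha hent n)

end FPaper
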